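/- Let n ≥ 1 and let D(n) = {(I,J) : I,J ⊆ {1,…,n}, |I| = |J|, I ∩ J = ∅, min(I∪J) ∈ I}. The fundamental hyperplane arrangement of the (n−1)-dimensional permutahedron in ℝⁿ (the convex hull of all permutations of (1,…,n)) is exactly the set of hyperplanes {Σ_{i∈I} x_i = Σ_{j∈J} x_j : (I,J) ∈ D(n)}; equivalently, the equivalence classes (up to scalar) of directions of edges of P ∩ ρ_zP over all z ∈ P are in bijection with the trinary vectors (coordinates in {0,1,−1}) having the same number of 1s and −1s and first nonzero coordinate equal to 1. -/

import Mathlib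

open scoped BigOperators

noncomputable section

/-- Vectors in `ℝⁿ`. -/
abbrev Vec (n : ℕ) := Fin n → ℝ

/-- The standard scalar product on `ℝⁿ`. -/
def dot {n : ℕ} (x y : Vec n) : ℝ := ∑ i, x i * y i

/-- A polytope is the convex hull of a finite set of points. -/
def IsPolytope {n : ℕ} (P : Set (Vec n)) : Prop :=
  ∃ S : Finset (Vec n), P = convexHull ℝ (S : Set (Vec n))

/-- A face of `P`: either `P` itself (take `c = 0`) or the subset of `P` where some linear
functional attains its maximum over `P`. -/
def IsFace {n : ℕ} (P F : Set (Vec n)) : Prop :=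
  ∃ c : Vec n, F = {x ∈ P | ∀ y ∈ P, dot c y ≤ dot c x}

/-- Dimension of a subset of `ℝⁿ`: the rank of the direction of its affine span. -/
noncomputable def sdim {n : ℕ} (A : Set (Vec n)) : ℕ :=
  Module.finrank ℝ (affineSpan ℝ A).direction

/-- The normal cone of a face `F` of `P`. -/
def normalCone {n : ℕ} (P F : Set (Vec n)) : Set (Vec n) :=
  {c | F ⊆ {x ∈ P | ∀ y ∈ P, dot c y ≤ dot c x}}

/-- `coneOf X`: nonnegative linear combinations of finitely many elements of `X`. -/
def coneOf {n : ℕ} (X : Set (Vec n)) : Set (Vec n) :=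
  {v | ∃ (k : ℕ) (x : Fin k → Vec n) (l : Fin k → ℝ),
      (∀ i, x i ∈ X) ∧ (∀ i, 0 ≤ l i) ∧ v = ∑ i, l i • x i}

/-- The reflection `ρ_z P = 2z - P` of `P` with respect to `z`. -/
def reflP {n : ℕ} (z : Vec n) (P : Set (Vec n)) : Set (Vec n) :=
  (fun x => (2 : ℝ) • z - x) '' P

/-- An edge is a 1-dimensional face. -/
def IsEdge {n : ℕ} (P E : Set (Vec n)) : Prop := IsFace P E ∧ sdim E = 1

/-- `(P, v)` is oriented if `v` is not perpendicular to any edge of `P`. -/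
def Oriented {n : ℕ} (P : Set (Vec n)) (v : Vec n) : Prop :=
  ∀ E, IsEdge P E → ∀ d ∈ (affineSpan ℝ E).direction, d ≠ 0 → dot d v ≠ 0

/-- `(P, v)` is positively oriented if `(P ∩ ρ_z P, v)` is oriented for every `z ∈ P`. -/
def PosOriented {n : ℕ} (P : Set (Vec n)) (v : Vec n) : Prop :=
  ∀ z ∈ P, Oriented (P ∩ reflP z P) v

/-- `x` is the minimizer of `⟨-, v⟩` on `P`. -/
def IsBotOf {n : ℕ} (P : Set (Vec n)) (v x : Vec n) : Prop :=
  x ∈ P ∧ ∀ y ∈ P, dot v x ≤ dot v y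

/-- `x` is the maximizer of `⟨-, v⟩` on `P`. -/
def IsTopOf {n : ℕ} (P : Set (Vec n)) (v x : Vec n) : Prop :=
  x ∈ P ∧ ∀ y ∈ P, dot v y ≤ dot v x

/-- `(P, v)` is quasi-oriented if `⟨-, v⟩` has a unique minimizer and a unique maximizer on `P`. -/
def QuasiOriented {n : ℕ} (P : Set (Vec n)) (v : Vec n) : Prop :=
  (∃! x, IsBotOf P v x) ∧ (∃! x, IsTopOf P v x)

/-- `(P, v)` is quasi-positively oriented if `(P ∩ ρ_z P, v)` is quasi-oriented for all `z ∈ P`. -/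
def QuasiPosOriented {n : ℕ} (P : Set (Vec n)) (v : Vec n) : Prop :=
  ∀ z ∈ P, QuasiOriented (P ∩ reflP z P) v

/-- The polytope `P^φ = π^φ(P × P) ⊆ ℝ^{n+1}`, where `π^φ(x,y) = ((x+y)/2, ⟨x - y, v⟩)`. -/
def Pphi {n : ℕ} (P : Set (Vec n)) (v : Vec n) : Set (Vec (n + 1)) :=
  {w | ∃ x ∈ P, ∃ y ∈ P, w = Fin.snoc ((1 / 2 : ℝ) • (x + y)) (dot (x - y) v)}

/-- The pair of faces `(F, G)` belongs to `F^φ`: there are no `x ∈ F`, `y ∈ G`, `λ > 0` with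
`(π(x,y), φ(x,y) - λ) ∈ P^φ`. -/
def InFphi {n : ℕ} (P : Set (Vec n)) (v : Vec n) (F G : Set (Vec n)) : Prop :=
  ¬ ∃ x ∈ F, ∃ y ∈ G, ∃ lam : ℝ, 0 < lam ∧
      (Fin.snoc ((1 / 2 : ℝ) • (x + y)) (dot (x - y) v - lam) : Vec (n + 1)) ∈ Pphi P v

/-- The set `(A + B)/2`. -/
def avgSet {n : ℕ} (A B : Set (Vec n)) : Set (Vec n) :=
  {z | ∃ x ∈ A, ∃ y ∈ B, z = (1 / 2 : ℝ) • (x + y)}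

/-- The coherent subdivision `π(F^φ)` is tight. -/
def TightSub {n : ℕ} (P : Set (Vec n)) (v : Vec n) : Prop :=
  ∀ F G : Set (Vec n), IsFace P F → IsFace P G → F.Nonempty → G.Nonempty →
    InFphi P v F G → sdim F + sdim G = sdim (avgSet F G)

/-- `d` is a direction of an edge of `P ∩ ρ_z P` for some `z ∈ P`; the hyperplanes of the
fundamental hyperplane arrangement `H_P` are the orthogonal complements of such directions. -/
def EdgeDir {n : ℕ} (P : Set (Vec n)) (d : Vec n) : Prop :=
  d ≠ 0 ∧ ∃ z ∈ P, ∃ E, IsEdge (P ∩ reflP z P) E ∧ d ∈ (affineSpan ℝ E).direction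

/-- The cone `cone(-N_P(F) ∪ N_P(G))`. -/
def diagCone {n : ℕ} (P F G : Set (Vec n)) : Set (Vec n) :=
  coneOf ((Neg.neg '' normalCone P F) ∪ normalCone P G)


/-- A planar rooted tree with `n` internal vertices labelled `0, …, n-1` in the clockwise-from-root
(depth-first preorder) order; `parent v` is the parent of the vertex `v`, the root being vertex `0`.
The internal edge `e : Fin (n-1)` connects the vertex `e+1` to its parent. -/
structure PTree (n : ℕ) where
  parent : Fin n → Fin n
  parent_zero : ∀ v : Fin n, v.val = 0 → parent v = v
  parent_lt : ∀ v : Fin n, 0 < v.val → (parent v).val < v.val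
  preorder : ∀ v w : Fin n, w.val = v.val + 1 → ∃ k : ℕ, parent^[k] v = parent w

/-- The child endpoint of the edge `e`: the vertex labelled `e + 1`. -/
def childV {n : ℕ} (e : Fin (n - 1)) : Fin n :=
  ⟨e.val + 1, by have h := e.isLt; omega⟩

/-- The vertices of the closure of a set of edges `N`, i.e. `V(t(N))`. -/
def nestVtx {n : ℕ} (t : PTree n) (N : Finset (Fin (n - 1))) : Finset (Fin n) :=
  N.biUnion fun e => {childV e, t.parent (childV e)}

/-- Two distinct edges are adjacent when they share a vertex. -/
def edgeAdj {n : ℕ} (t : PTree n) (e f : Fin (n - 1)) : Prop :=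
  e ≠ f ∧ (({childV e, t.parent (childV e)} ∩ {childV f, t.parent (childV f)} :
      Finset (Fin n))).Nonempty

instance {n : ℕ} (t : PTree n) (e f : Fin (n - 1)) : Decidable (edgeAdj t e f) := by
  unfold edgeAdj; infer_instance

/-- A nest: a set of edges whose closure is a connected subgraph (the trivial nest `E(t)` is
also allowed when `n = 1`, where it is empty). -/
def IsNest {n : ℕ} (t : PTree n) (N : Finset (Fin (n - 1))) : Prop :=
  (N.Nonempty ∨ N = Finset.univ) ∧
    ∀ e ∈ N, ∀ f ∈ N,
      Relation.ReflTransGen (fun a b => a ∈ N ∧ b ∈ N ∧ edgeAdj t a b) e f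

/-- A nesting: a set of nests containing the trivial nest, any two of which are nested or
disjoint, disjoint ones having no adjacent edges. -/
def IsNesting {n : ℕ} (t : PTree n) (𝒩 : Finset (Finset (Fin (n - 1)))) : Prop :=
  (∀ N ∈ 𝒩, IsNest t N) ∧ Finset.univ ∈ 𝒩 ∧
    ∀ N ∈ 𝒩, ∀ M ∈ 𝒩,
      N ⊆ M ∨ M ⊆ N ∨ (Disjoint N M ∧ ∀ e ∈ N, ∀ f ∈ M, ¬ edgeAdj t e f)

/-- A maximal nesting: a nesting of (maximal) cardinality `n - 1`. -/
def IsMaxNesting {n : ℕ} (t : PTree n) (𝒩 : Finset (Finset (Fin (n - 1)))) : Prop :=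
  IsNesting t 𝒩 ∧ 𝒩.card = n - 1

/-- `min 𝒩(i)`: the smallest nest of `𝒩` containing the edge `i` (the nests of a nesting
containing `i` being totally ordered, this is their intersection). -/
def minNest {n : ℕ} (𝒩 : Finset (Finset (Fin (n - 1)))) (i : Fin (n - 1)) :
    Finset (Fin (n - 1)) :=
  (𝒩.filter fun N => i ∈ N).inf id

/-- `u` is a weak ancestor of `w` (any ancestor is reached in at most `n` steps). -/
def isAnc {n : ℕ} (t : PTree n) (u w : Fin n) : Prop :=
  ∃ k ∈ Finset.range (n + 1), t.parent^[k] w = u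

instance {n : ℕ} (t : PTree n) (u w : Fin n) : Decidable (isAnc t u w) := by
  unfold isAnc; infer_instance

/-- `α_i`: the total weight of the subtree `t₁` of `t(min𝒩(i))` having the edge `i` as root. -/
def alphaN {n : ℕ} (t : PTree n) (𝒩 : Finset (Finset (Fin (n - 1))))
    (ω : Fin n → ℤ) (i : Fin (n - 1)) : ℤ :=
  ∑ w ∈ (nestVtx t (minNest 𝒩 i)).filter (fun w => isAnc t (childV i) w), ω w

/-- `β_i`: the total weight of the subtree `t₂` of `t(min𝒩(i))` having the edge `i` as a leaf. -/
def betaN {n : ℕ} (t : PTree n) (𝒩 : Finset (Finset (Fin (n - 1))))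
    (ω : Fin n → ℤ) (i : Fin (n - 1)) : ℤ :=
  ∑ w ∈ (nestVtx t (minNest 𝒩 i)).filter (fun w => ¬ isAnc t (childV i) w), ω w

/-- The point `M(t, 𝒩, ω) = (α₁β₁, …, α_{n-1}β_{n-1})`. -/
noncomputable def MPoint {n : ℕ} (t : PTree n) (𝒩 : Finset (Finset (Fin (n - 1))))
    (ω : Fin n → ℤ) : Vec (n - 1) :=
  fun i => ((alphaN t 𝒩 ω i : ℤ) : ℝ) * ((betaN t 𝒩 ω i : ℤ) : ℝ)

/-- The Loday realization `P_{(t,ω)}` of the operahedron. -/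
noncomputable def Loday {n : ℕ} (t : PTree n) (ω : Fin n → ℤ) : Set (Vec (n - 1)) :=
  convexHull ℝ {x | ∃ 𝒩, IsMaxNesting t 𝒩 ∧ x = MPoint t 𝒩 ω}

/-- The face of `P_{(t,ω)}` associated to a nesting `𝒩`: the convex hull of the points
`M(t,𝒩',ω)` over the maximal nestings `𝒩' ⊇ 𝒩`. -/
noncomputable def faceOfNesting {n : ℕ} (t : PTree n) (ω : Fin n → ℤ)
    (𝒩 : Finset (Finset (Fin (n - 1)))) : Set (Vec (n - 1)) :=
  convexHull ℝ {x | ∃ 𝒩', IsMaxNesting t 𝒩' ∧ 𝒩 ⊆ 𝒩' ∧ x = MPoint t 𝒩' ω}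

/-- A pair `(I, J) ∈ D(m)`: disjoint subsets of the same cardinality with `min (I ∪ J) ∈ I`. -/
def DPair {m : ℕ} (I J : Finset (Fin m)) : Prop :=
  I.card = J.card ∧ Disjoint I J ∧ ∃ i ∈ I, ∀ x ∈ I ∪ J, i ≤ x

/-- A trinary vector: all coordinates are `0`, `1` or `-1`. -/
def Trinary {m : ℕ} (u : Vec m) : Prop := ∀ i, u i = 0 ∨ u i = 1 ∨ u i = -1

/-- A balanced vector: same number of coordinates equal to `1` and to `-1`. -/
def BalancedVec {m : ℕ} (u : Vec m) : Prop :=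
  (Finset.univ.filter fun i => u i = 1).card = (Finset.univ.filter fun i => u i = -1).card

/-- The first nonzero coordinate is `1`. -/
def FirstPos {m : ℕ} (u : Vec m) : Prop :=
  ∀ i, u i ≠ 0 → (∀ j, j < i → u j = 0) → u i = 1
/-- The `(n-1)`-dimensional permutahedron: the convex hull in `ℝⁿ` of all the permutations of
the coordinates of `(1, 2, …, n)`. -/
def Permutohedron (n : ℕ) : Set (Vec n) :=
  convexHull ℝ {x | ∃ σ : Equiv.Perm (Fin n), x = fun i => ((σ i : ℕ) : ℝ) + 1}

/-- The sum `1 + 2 + ⋯ + k`. -/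
def triangular (k : ℕ) : ℝ := k * (k + 1) / 2

lemma triangular_succ (k : ℕ) : triangular (k + 1) = triangular k + (k + 1) := by
  unfold triangular
  push_cast
  ring

/-- `triangular` is strictly supermodular along set sizes. -/
lemma triangular_add_lt {a b c d : ℕ} (h : a + b = c + d) (hc : c < a) (hb : c < b) :
    triangular a + triangular b < triangular c + triangular d := by
  obtain ⟨p, rfl⟩ := Nat.exists_eq_add_of_lt hc
  obtain ⟨q, rfl⟩ := Nat.exists_eq_add_of_lt hb
  obtain rfl : d = c + p + q + 2 := by omega
  unfold triangular
  push_cast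
  have hp : (0 : ℝ) ≤ p := p.cast_nonneg
  have hq : (0 : ℝ) ≤ q := q.cast_nonneg
  nlinarith [mul_nonneg hp hq]

lemma triangular_card_le_sum (T : Finset ℕ) : triangular T.card ≤ ∑ t ∈ T, ((t : ℝ) + 1) := by
  induction T using Finset.induction_on_max with
  | empty => simp [triangular]
  | insert a s hs ih =>
    have ha : a ∉ s := fun h => (hs a h).false
    have hcard : s.card ≤ a := by
      simpa using Finset.card_le_card (t := Finset.range a) fun x hx => by simpa using hs x hx
    rw [Finset.card_insert_of_notMem ha, triangular_succ, Finset.sum_insert ha]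
    have : (s.card : ℝ) ≤ a := by exact_mod_cast hcard
    linarith

lemma sum_fin_val_add_one (n : ℕ) : ∑ i : Fin n, ((i : ℕ) + 1 : ℝ) = triangular n := by
  induction n with
  | zero => simp [triangular]
  | succ k ih => rw [Fin.sum_univ_castSucc, triangular_succ]; simp [ih]

/-- The vertex of the permutahedron given by a permutation. -/
def permVertex {n : ℕ} (σ : Equiv.Perm (Fin n)) : Vec n := fun i => ((σ i : ℕ) : ℝ) + 1

lemma permVertex_mem {n : ℕ} (σ : Equiv.Perm (Fin n)) : permVertex σ ∈ Permutohedron n :=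
  subset_convexHull ℝ _ ⟨σ, rfl⟩

lemma convex_permutohedron (n : ℕ) : Convex ℝ (Permutohedron n) := convex_convexHull ℝ _

lemma triangular_card_le_sum_of_mem {n : ℕ} {x : Vec n} (hx : x ∈ Permutohedron n)
    (S : Finset (Fin n)) : triangular S.card ≤ ∑ i ∈ S, x i := by
  have hconv : Convex ℝ {y : Vec n | triangular S.card ≤ ∑ i ∈ S, y i} := by
    refine convex_halfSpace_ge (f := fun y : Vec n => ∑ i ∈ S, y i) ⟨?_, ?_⟩ _
    · intro y z; simp [Finset.sum_add_distrib]
    · intro c y; simp [Finset.mul_sum]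
  refine convexHull_min ?_ hconv hx
  rintro _ ⟨σ, rfl⟩
  have h := triangular_card_le_sum (S.map (σ.toEmbedding.trans Fin.valEmbedding))
  simpa using h

lemma sum_eq_triangular_of_mem {n : ℕ} {x : Vec n} (hx : x ∈ Permutohedron n) :
    ∑ i, x i = triangular n := by
  have hconv : Convex ℝ {y : Vec n | ∑ i, y i = triangular n} := by
    refine convex_hyperplane (f := fun y : Vec n => ∑ i, y i) ⟨?_, ?_⟩ _
    · intro y z; simp [Finset.sum_add_distrib]
    · intro c y; simp [Finset.mul_sum]
  refine convexHull_min ?_ hconv hx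
  rintro _ ⟨σ, rfl⟩
  simp only [Set.mem_ofPred_eq]
  rw [Equiv.sum_comp σ fun i => ((i : ℕ) : ℝ) + 1, sum_fin_val_add_one]

/-- Abel summation bound for a monotone weight against nonpositive partial sums. -/
lemma mul_initial_sum_le {g w : ℕ → ℝ} {m : ℕ} (hg : MonotoneOn g (Set.Iic m))
    (hw : ∀ k ≤ m, ∑ i ∈ Finset.range k, w i ≤ 0) :
    g m * ∑ i ∈ Finset.range (m + 1), w i ≤ ∑ i ∈ Finset.range (m + 1), g i * w i := by
  induction m with
  | zero => simp
  | succ m ih =>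
    have h := ih (hg.mono (Set.Iic_subset_Iic.2 m.le_succ)) fun k hk => hw k (by omega)
    have hgm : g m ≤ g (m + 1) := hg (by simp) (by simp) m.le_succ
    have := hw (m + 1) le_rfl
    rw [Finset.sum_range_succ _ (m + 1), Finset.sum_range_succ (fun i => g i * w i) (m + 1)]
    nlinarith

lemma dot_le_permVertex {n : ℕ} {x : Vec n} (hx : ∀ S : Finset (Fin n),
    triangular S.card ≤ ∑ i ∈ S, x i) (hsum : ∑ i, x i = triangular n) (c : Vec n) :
    ∃ σ : Equiv.Perm (Fin n), dot c x ≤ dot c (permVertex σ) := by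
  obtain _ | m := n
  · exact ⟨1, by simp [dot]⟩
  set τ := Tuple.sort c
  have hmono : Monotone (c ∘ τ) := Tuple.monotone_sort c
  refine ⟨τ.symm, ?_⟩
  let e : ℕ → Fin (m + 1) := fun k => τ (Fin.ofNat (m + 1) k)
  have hval : ∀ k ≤ m, ((Fin.ofNat (m + 1) k : Fin (m + 1)) : ℕ) = k := fun k hk => by
    simp [Nat.mod_eq_of_lt (Nat.lt_succ_of_le hk)]
  have hinitial : ∀ k ≤ m + 1,
      ∑ i ∈ Finset.range k, ((i : ℝ) + 1 - x (e i)) ≤ 0 := by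
    intro k hk
    have hinj : Set.InjOn e (Finset.range k : Set ℕ) := by
      intro a ha b hb hab
      simp only [Finset.coe_range, Set.mem_Iio] at ha hb
      have := congrArg Fin.val (τ.injective hab)
      rwa [hval a (by omega), hval b (by omega)] at this
    have h := hx ((Finset.range k).image e)
    rw [Finset.card_image_of_injOn hinj, Finset.sum_image hinj, Finset.card_range] at h
    rw [Finset.sum_sub_distrib, Finset.sum_range, sum_fin_val_add_one]
    linarith
  have hsumrange : ∀ f : Fin (m + 1) → ℝ, ∑ i ∈ Finset.range (m + 1), f (e i) = ∑ i, f i := by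
    intro f
    rw [Finset.sum_range, ← Equiv.sum_comp τ f]
    refine Finset.sum_congr rfl fun i _ => ?_
    simp [e]
  have key := mul_initial_sum_le (g := fun k => c (e k)) (w := fun i => (i : ℝ) + 1 - x (e i))
    (m := m) (fun a ha b hb hab => hmono (by
      rw [Fin.le_def, hval a ha, hval b hb]; exact hab)) fun k hk => hinitial k (by omega)
  rw [Finset.sum_sub_distrib (s := Finset.range (m + 1)), hsumrange x, hsum,
    Finset.sum_range (fun i => (i : ℝ) + 1), sum_fin_val_add_one, sub_self, mul_zero] at key
  have hrw : ∑ i ∈ Finset.range (m + 1), c (e i) * ((i : ℝ) + 1 - x (e i)) =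
      dot c (permVertex τ.symm) - dot c x := by
    unfold dot
    rw [← Finset.sum_sub_distrib, ← hsumrange]
    refine Finset.sum_congr rfl fun i hi => ?_
    have hi' : i ≤ m := by simpa [Nat.lt_succ_iff] using hi
    have : ((τ.symm (e i) : Fin (m + 1)) : ℕ) = i := by rw [Equiv.symm_apply_apply, hval i hi']
    simp only [permVertex, this]
    ring
  linarith

/-- Rado's theorem for the permutahedron. -/
lemma mem_permutohedron_iff {n : ℕ} {x : Vec n} : x ∈ Permutohedron n ↔
    (∀ S : Finset (Fin n), triangular S.card ≤ ∑ i ∈ S, x i) ∧ ∑ i, x i = triangular n := by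
  refine ⟨fun h => ⟨triangular_card_le_sum_of_mem h, sum_eq_triangular_of_mem h⟩, fun ⟨h, hs⟩ => ?_⟩
  by_contra hx
  have hfin : {x : Vec n | ∃ σ : Equiv.Perm (Fin n), x = permVertex σ}.Finite :=
    (Set.finite_range (permVertex (n := n))).subset (by rintro _ ⟨σ, rfl⟩; exact ⟨σ, rfl⟩)
  obtain ⟨f, u, hf, hu⟩ := geometric_hahn_banach_closed_point (convex_permutohedron n)
    (hfin.isClosed_convexHull ℝ) hx
  have hdot : ∀ y, f y = dot (fun i => f (Pi.single i 1)) y := by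
    intro y
    have := f.toLinearMap.pi_apply_eq_sum_univ y
    simp only [ContinuousLinearMap.coe_coe, smul_eq_mul] at this
    rw [this, dot]
    refine Finset.sum_congr rfl fun i _ => ?_
    rw [mul_comm]
    congr 2
    ext j
    simp [Pi.single_apply, eq_comm]
  obtain ⟨σ, hσ⟩ := dot_le_permVertex h hs fun i => f (Pi.single i 1)
  rw [← hdot, ← hdot] at hσ
  linarith [hf _ (permVertex_mem σ)]

/-- The sets whose defining inequality of the permutahedron is an equality at `x`. -/
def tightSets {n : ℕ} (x : Vec n) : Finset (Finset (Fin n)) :=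
  Finset.univ.filter fun S => ∑ i ∈ S, x i = triangular S.card

/-- `d` annihilates all the constraints of the permutahedron which are tight at `x`. -/
def TightDir {n : ℕ} (x d : Vec n) : Prop := ∀ S ∈ tightSets x, ∑ i ∈ S, d i = 0

/-- The tight sets containing a given index; its fibers are the blocks of the ordered partition
defined by the tight sets. -/
def tightLabel {n : ℕ} (x : Vec n) (i : Fin n) : Finset (Finset (Fin n)) :=
  (tightSets x).filter fun S => i ∈ S

/-- Tight sets form a chain. -/
lemma tightSets_chain {n : ℕ} {x : Vec n} (hx : x ∈ Permutohedron n) {S T : Finset (Fin n)}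
    (hS : S ∈ tightSets x) (hT : T ∈ tightSets x) : S ⊆ T ∨ T ⊆ S := by
  by_contra! h
  simp only [tightSets, Finset.mem_filter, Finset.mem_univ, true_and] at hS hT
  have h1 := triangular_card_le_sum_of_mem hx (S ∪ T)
  have h2 := triangular_card_le_sum_of_mem hx (S ∩ T)
  have h3 := Finset.sum_union_inter (s₁ := S) (s₂ := T) (f := x)
  have h4 := triangular_add_lt (a := S.card) (b := T.card) (c := (S ∩ T).card)
    (d := (S ∪ T).card) (by rw [add_comm (S ∩ T).card, Finset.card_union_add_card_inter])
    (Finset.card_lt_card ⟨Finset.inter_subset_left, fun h' => h.1 (h'.trans Finset.inter_subset_right)⟩)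
    (Finset.card_lt_card ⟨Finset.inter_subset_right, fun h' => h.2 (h'.trans Finset.inter_subset_left)⟩)
  linarith

lemma TightDir.sum_fiber_eq_zero {n : ℕ} {x d : Vec n} (hx : x ∈ Permutohedron n)
    (hd : TightDir x d) (l : Finset (Finset (Fin n))) :
    ∑ j with tightLabel x j = l, d j = 0 := by
  by_cases hl : ∃ i, tightLabel x i = l
  swap
  · rw [Finset.filter_false_of_mem fun j _ hj => hl ⟨j, hj⟩, Finset.sum_empty]
  obtain ⟨i, rfl⟩ := hl
  have huniv : Finset.univ ∈ tightSets x := by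
    simp [tightSets, sum_eq_triangular_of_mem hx]
  have hempty : ∅ ∈ tightSets x := by
    rw [tightSets, Finset.mem_filter]
    simp [triangular]
  obtain ⟨A, hA, hAmin⟩ := Finset.exists_min_image
    ((tightSets x).filter fun S => i ∈ S) Finset.card ⟨Finset.univ, by simpa using huniv⟩
  obtain ⟨B, hB, hBmax⟩ := Finset.exists_max_image
    ((tightSets x).filter fun S => i ∉ S) Finset.card ⟨∅, by simpa using hempty⟩
  simp only [Finset.mem_filter] at hA hB hAmin hBmax
  have hA' : ∀ S ∈ tightSets x, i ∈ S → A ⊆ S := fun S hS hi =>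
    (tightSets_chain hx hA.1 hS).elim id fun h =>
      (Finset.eq_of_subset_of_card_le h (hAmin S ⟨hS, hi⟩)).ge
  have hB' : ∀ S ∈ tightSets x, i ∉ S → S ⊆ B := fun S hS hi =>
    (tightSets_chain hx hS hB.1).elim id fun h =>
      (Finset.eq_of_subset_of_card_le h (hBmax S ⟨hS, hi⟩)).ge
  have hBA : B ⊆ A := (tightSets_chain hx hB.1 hA.1).resolve_right fun h => hB.2 (h hA.2)
  have hfiber : (Finset.univ.filter fun j => tightLabel x j = tightLabel x i) = A \ B := by
    ext j
    simp only [Finset.mem_filter, Finset.mem_univ, true_and, Finset.mem_sdiff, Finset.ext_iff,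
      tightLabel]
    constructor
    · intro h
      have h1 := h A
      have h2 := h B
      tauto
    · rintro ⟨hjA, hjB⟩ S
      by_cases hi : i ∈ S
      · have := fun hS => hA' S hS hi hjA
        tauto
      · have := fun hS hj => hjB (hB' S hS hi hj)
        tauto
  have := Finset.sum_sdiff hBA (f := d)
  rw [hd B hB.1, hd A hA.1, add_zero] at this
  rw [hfiber, this]

lemma tightDir_of_sum_fiber_eq_zero {n : ℕ} {x d : Vec n}
    (hd : ∀ l, ∑ j with tightLabel x j = l, d j = 0) : TightDir x d := by
  intro S hS
  rw [← Finset.sum_fiberwise_of_maps_to (g := tightLabel x) (t := S.image (tightLabel x))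
    fun i hi => Finset.mem_image_of_mem _ hi]
  refine Finset.sum_eq_zero fun l hl => ?_
  obtain ⟨i, hi, rfl⟩ := Finset.mem_image.1 hl
  rw [← hd (tightLabel x i)]
  refine Finset.sum_congr ?_ fun _ _ => rfl
  ext j
  simp only [Finset.mem_filter, Finset.mem_univ, true_and, and_iff_right_iff_imp]
  intro h
  have : S ∈ tightLabel x j := by rw [h]; simp [tightLabel, hS, hi]
  exact (Finset.mem_filter.1 this).2

/-- The midpoint of a segment in the permutahedron can be moved along the segment. -/
lemma tightDir_midpoint {n : ℕ} {p q : Vec n} (hp : p ∈ Permutohedron n)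
    (hq : q ∈ Permutohedron n) : TightDir ((1 / 2 : ℝ) • (p + q)) (q - p) := by
  intro S hS
  simp only [tightSets, Finset.mem_filter, Finset.mem_univ, true_and, Pi.smul_apply, Pi.add_apply,
    smul_eq_mul, ← Finset.mul_sum, Finset.sum_add_distrib] at hS
  simp only [Pi.sub_apply, Finset.sum_sub_distrib]
  have h1 := triangular_card_le_sum_of_mem hp S
  have h2 := triangular_card_le_sum_of_mem hq S
  linarith

open Filter Topology in
lemma TightDir.eventually_mem {n : ℕ} {x d : Vec n} (hx : x ∈ Permutohedron n)
    (hd : TightDir x d) : ∀ᶠ t : ℝ in 𝓝 0, x + t • d ∈ Permutohedron n := by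
  have hsum : ∀ (S : Finset (Fin n)) (t : ℝ),
      ∑ i ∈ S, (x + t • d) i = ∑ i ∈ S, x i + t * ∑ i ∈ S, d i := fun S t => by
    simp [Finset.sum_add_distrib, Finset.mul_sum]
  have hall : ∀ᶠ t : ℝ in 𝓝 0, ∀ S : Finset (Fin n),
      triangular S.card ≤ ∑ i ∈ S, (x + t • d) i := by
    refine eventually_all.2 fun S => ?_
    simp only [hsum]
    by_cases hS : S ∈ tightSets x
    · simpa [hd S hS] using triangular_card_le_sum_of_mem hx S
    · have hlt : triangular S.card < ∑ i ∈ S, x i :=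
        lt_of_le_of_ne (triangular_card_le_sum_of_mem hx S) fun h => hS (by simp [tightSets, h])
      have hcont : ContinuousAt (fun t : ℝ => ∑ i ∈ S, x i + t * ∑ i ∈ S, d i) 0 := by fun_prop
      exact (hcont.eventually (lt_mem_nhds (by simpa using hlt))).mono fun t ht => ht.le
  filter_upwards [hall] with t ht
  refine mem_permutohedron_iff.2 ⟨ht, ?_⟩
  rw [hsum, hd Finset.univ (by simp [tightSets, sum_eq_triangular_of_mem hx]),
    sum_eq_triangular_of_mem hx, mul_zero, add_zero]

lemma card_image_mul_two_le {ι α : Type*} [DecidableEq α] {F : Finset ι} {g : ι → α}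
    (hg : ∀ i ∈ F, ∃ j ∈ F, j ≠ i ∧ g j = g i) : (F.image g).card * 2 ≤ F.card := by
  rw [mul_comm]
  refine Finset.mul_card_image_le_card F 2 fun k hk => ?_
  obtain ⟨i, hi, rfl⟩ := Finset.mem_image.1 hk
  obtain ⟨j, hj, hji, hgj⟩ := hg i hi
  exact Finset.one_lt_card.2 ⟨j, by simp [hj, hgj], i, by simp [hi], hji⟩

/-- The linear map taking a vector on `F` to its sums over the blocks of the partition by `g`. -/
def blockSums {ι α : Type*} [DecidableEq α] (F : Finset ι) (g : ι → α) :
    (F → ℝ) →ₗ[ℝ] (F.image g → ℝ) where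
  toFun d k := ∑ j ∈ F.attach with g j.1 = k, d j
  map_add' d e := by ext k; simp [Finset.sum_add_distrib]
  map_smul' c d := by ext k; simp [Finset.mul_sum]

lemma sum_blockSums {ι α : Type*} [DecidableEq α] (F : Finset ι) (g : ι → α) (d : F → ℝ) :
    ∑ k, blockSums F g d k = ∑ j, d j := by
  rw [← Finset.sum_fiberwise (s := Finset.univ)
    (g := fun j : F => (⟨g j, Finset.mem_image_of_mem g j.2⟩ : F.image g))]
  simp [blockSums, Subtype.ext_iff]

lemma sum_fiber_extend_eq_zero {ι α : Type*} [Fintype ι] [DecidableEq ι] [DecidableEq α]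
    {F : Finset ι} {g : ι → α} {d : F → ℝ} (hd : blockSums F g d = 0) (k : α) :
    ∑ j with g j = k, (if h : j ∈ F then d ⟨j, h⟩ else 0) = 0 := by
  have hsum : ∑ j with g j = k, (if h : j ∈ F then d ⟨j, h⟩ else 0) =
      ∑ j ∈ F.attach with g j.1 = k, d j := by
    rw [Finset.sum_filter, Finset.sum_filter,
      ← Finset.sum_subset (Finset.subset_univ F) (by intro x _ hx; simp [hx]),
      ← Finset.sum_attach F]
    refine Finset.sum_congr rfl fun j _ => ?_
    simp
  rw [hsum]
  by_cases hk : k ∈ F.image g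
  · exact congrFun hd ⟨k, hk⟩
  · refine Finset.sum_eq_zero fun j hj => ?_
    exact absurd ((Finset.mem_filter.1 hj).2 ▸ Finset.mem_image_of_mem g j.2) hk

/-- If two partitions have no block meeting `F` in exactly one element, then some nonzero vector
supported on `F` has zero sum over all the blocks of both partitions. -/
lemma exists_ne_zero_sum_fiber_eq_zero {ι α β : Type*} [Fintype ι] [DecidableEq ι] [DecidableEq α]
    [DecidableEq β] (a : ι → α) (b : ι → β) {F : Finset ι} (hF : F.Nonempty)
    (ha : ∀ i ∈ F, ∃ j ∈ F, j ≠ i ∧ a j = a i) (hb : ∀ i ∈ F, ∃ j ∈ F, j ≠ i ∧ b j = b i) :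
    ∃ d : ι → ℝ, d ≠ 0 ∧ (∀ i ∉ F, d i = 0) ∧ (∀ k, ∑ j with a j = k, d j = 0) ∧
      ∀ k, ∑ j with b j = k, d j = 0 := by
  set L := (blockSums F a).prod (blockSums F b) with hL
  have hker : ∃ d, L d = 0 ∧ d ≠ 0 := by
    by_contra! hinj
    have hfin := LinearMap.finrank_range_of_inj (f := L)
      (LinearMap.ker_eq_bot.1 ((Submodule.eq_bot_iff _).2 fun d hd => hinj d hd))
    have hlt : Module.finrank ℝ (LinearMap.range L) <
        Module.finrank ℝ ((F.image a → ℝ) × (F.image b → ℝ)) := by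
      refine Submodule.finrank_lt (fun htop => ?_)
      obtain ⟨i, hi⟩ := hF
      obtain ⟨d, hd⟩ : (Pi.single ⟨a i, Finset.mem_image_of_mem a hi⟩ 1, 0) ∈ LinearMap.range L :=
        htop ▸ Submodule.mem_top
      have h1 := sum_blockSums F a d
      have h2 := sum_blockSums F b d
      replace hd := Prod.mk.inj hd
      rw [hd.1] at h1
      rw [hd.2] at h2
      simpa using h1.trans h2.symm
    have h1 := card_image_mul_two_le ha
    have h2 := card_image_mul_two_le hb
    simp only [Module.finrank_prod, Module.finrank_fintype_fun_eq_card, Fintype.card_coe] at hlt hfin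
    omega
  obtain ⟨d, hd, hd0⟩ := hker
  replace hd : blockSums F a d = 0 ∧ blockSums F b d = 0 := Prod.mk_eq_zero.1 hd
  refine ⟨fun j => if h : j ∈ F then d ⟨j, h⟩ else 0, fun h => hd0 ?_, fun i hi => by simp [hi],
    sum_fiber_extend_eq_zero hd.1, sum_fiber_extend_eq_zero hd.2⟩
  ext j
  simpa using congrFun h j

/-- In a block of integer sum, an element with nonintegral entry is not alone. -/
lemma exists_ne_notMem_range_intCast {ι α : Type*} [Fintype ι] [DecidableEq ι] [DecidableEq α]
    {g : ι → α} {d : ι → ℝ} (hd : ∀ k, ∑ j with g j = k, d j = 0) {i : ι}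
    (hi : d i ∉ (Int.castAddHom ℝ).range) :
    ∃ j, d j ∉ (Int.castAddHom ℝ).range ∧ j ≠ i ∧ g j = g i := by
  by_contra! h
  refine hi ?_
  have h1 := Finset.add_sum_erase (Finset.univ.filter fun j => g j = g i) d (a := i) (by simp)
  rw [hd, ← eq_neg_iff_add_eq_zero] at h1
  rw [h1]
  refine neg_mem (sum_mem fun j hj => ?_)
  simp only [Finset.mem_erase, Finset.mem_filter, Finset.mem_univ, true_and] at hj
  by_contra hj'
  exact h j hj' hj.1 hj.2

/-- If the vectors with zero sums over the blocks of two partitions form a line, this line is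
spanned by a trinary vector. -/
lemma exists_trinary_smul {n : ℕ} {α β : Type*} [DecidableEq α] [DecidableEq β] {a : Fin n → α}
    {b : Fin n → β} {d : Vec n} (hd0 : d ≠ 0) (ha : ∀ k, ∑ j with a j = k, d j = 0)
    (hb : ∀ k, ∑ j with b j = k, d j = 0)
    (h : ∀ e : Vec n, (∀ k, ∑ j with a j = k, e j = 0) → (∀ k, ∑ j with b j = k, e j = 0) →
      ∃ c : ℝ, e = c • d) :
    ∃ (c : ℝ) (u : Vec n), c ≠ 0 ∧ Trinary u ∧ d = c • u := by
  obtain ⟨i₀, hi₀⟩ := Function.ne_iff.1 hd0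
  obtain ⟨m, -, hm⟩ := Finset.exists_max_image Finset.univ (fun i => |d i|) ⟨i₀, Finset.mem_univ _⟩
  have hm0 : d m ≠ 0 := fun h0 => hi₀ (by simpa [h0] using hm i₀ (Finset.mem_univ _))
  set u : Vec n := (d m)⁻¹ • d with hu
  have hdu : d = d m • u := by rw [hu, smul_inv_smul₀ hm0]
  have hum : u m = 1 := by simp [hu, hm0]
  have huabs : ∀ i, |u i| ≤ 1 := fun i => by
    rw [hu, Pi.smul_apply, smul_eq_mul, abs_mul, abs_inv, ← div_eq_inv_mul,
      div_le_one (abs_pos.2 hm0)]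
    exact hm i (Finset.mem_univ _)
  have hua : ∀ k, ∑ j with a j = k, u j = 0 := fun k => by
    simp [hu, ← Finset.mul_sum, ha]
  have hub : ∀ k, ∑ j with b j = k, u j = 0 := fun k => by
    simp [hu, ← Finset.mul_sum, hb]
  have hint : ∀ i, u i ∈ (Int.castAddHom ℝ).range := by
    by_contra! hne
    obtain ⟨i, hi⟩ := hne
    classical
    obtain ⟨e, he0, heF, hea, heb⟩ := exists_ne_zero_sum_fiber_eq_zero a b
      (F := Finset.univ.filter fun j => u j ∉ (Int.castAddHom ℝ).range) ⟨i, by simpa using hi⟩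
      (fun j hj => by
        simpa using exists_ne_notMem_range_intCast hua (Finset.mem_filter.1 hj).2)
      (fun j hj => by
        simpa using exists_ne_notMem_range_intCast hub (Finset.mem_filter.1 hj).2)
    obtain ⟨c, rfl⟩ := h e hea heb
    have := heF m (by simp [hum])
    simp only [Pi.smul_apply, smul_eq_mul, mul_eq_zero, hm0, or_false] at this
    simp [this] at he0
  refine ⟨d m, u, hm0, fun i => ?_, hdu⟩
  obtain ⟨k, hk⟩ := hint i
  have hk' : (k : ℝ) = u i := hk
  have := huabs i
  rw [← hk'] at this ⊢
  have hk1 : |k| ≤ 1 := by exact_mod_cast this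
  rw [abs_le] at hk1
  obtain rfl | rfl | rfl : k = 0 ∨ k = 1 ∨ k = -1 := by omega
  all_goals simp

lemma Trinary.sum_eq {n : ℕ} {u : Vec n} (hu : Trinary u) :
    ∑ i, u i = (Finset.univ.filter fun i => u i = 1).card -
      ((Finset.univ.filter fun i => u i = -1).card : ℝ) := by
  rw [Finset.card_filter, Finset.card_filter]
  push_cast
  rw [← Finset.sum_sub_distrib]
  refine Finset.sum_congr rfl fun i _ => ?_
  obtain h | h | h := hu i <;> rw [h] <;> norm_num

lemma mem_reflP {n : ℕ} {z w : Vec n} {P : Set (Vec n)} :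
    w ∈ reflP z P ↔ (2 : ℝ) • z - w ∈ P := by
  constructor
  · rintro ⟨x, hx, rfl⟩
    simpa using hx
  · exact fun h => ⟨_, h, by simp⟩

lemma dot_add_smul {n : ℕ} (c x d : Vec n) (t : ℝ) : dot c (x + t • d) = dot c x + t * dot c d := by
  simp only [dot, Pi.add_apply, Pi.smul_apply, smul_eq_mul, mul_add, Finset.sum_add_distrib,
    Finset.mul_sum]
  congr 1
  exact Finset.sum_congr rfl fun i _ => by ring

/-- A point of a face which can be moved both ways in the polytope moves inside the face. -/
lemma smul_mem_direction_of_face {n : ℕ} {Q : Set (Vec n)} {c x d : Vec n} {t : ℝ} (ht : t ≠ 0)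
    (hx : x ∈ {x ∈ Q | ∀ y ∈ Q, dot c y ≤ dot c x}) (h1 : x + t • d ∈ Q) (h2 : x + (-t) • d ∈ Q) :
    d ∈ (affineSpan ℝ {x ∈ Q | ∀ y ∈ Q, dot c y ≤ dot c x}).direction := by
  have e1 := hx.2 _ h1
  have e2 := hx.2 _ h2
  rw [dot_add_smul] at e1 e2
  have hmem : x + t • d ∈ {x ∈ Q | ∀ y ∈ Q, dot c y ≤ dot c x} := by
    refine ⟨h1, fun y hy => ?_⟩
    rw [dot_add_smul]
    linarith [hx.2 y hy]
  have := vsub_mem_vectorSpan ℝ hmem hx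
  rw [direction_affineSpan]
  simpa [ht] using Submodule.smul_mem _ t⁻¹ this

/-- Edge directions of `P ∩ ρ_z P` are multiples of balanced trinary vectors. -/
lemma EdgeDir.exists_trinary {n : ℕ} {d : Vec n} (hd : EdgeDir (Permutohedron n) d) :
    ∃ (c : ℝ) (u : Vec n), c ≠ 0 ∧ u ≠ 0 ∧ Trinary u ∧ BalancedVec u ∧ d = c • u := by
  obtain ⟨hd0, z, -, E, ⟨⟨f, rfl⟩, hdim⟩, hdE⟩ := hd
  set Q := Permutohedron n ∩ reflP z (Permutohedron n) with hQ
  set E := {x ∈ Q | ∀ y ∈ Q, dot f y ≤ dot f x} with hE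
  obtain ⟨p, hp, q, hq, hpq⟩ : E.Nontrivial := by
    by_contra hE
    rw [Set.not_nontrivial_iff] at hE
    rw [sdim, direction_affineSpan, vectorSpan_of_subsingleton ℝ hE, finrank_bot] at hdim
    exact zero_ne_one hdim
  have hspan : ∀ e ∈ (affineSpan ℝ E).direction, ∃ c : ℝ, e = c • d := fun e he => by
    obtain ⟨c, hc⟩ := (finrank_eq_one_iff_of_nonzero' (⟨d, hdE⟩ : (affineSpan ℝ E).direction)
      (by simpa [Subtype.ext_iff] using hd0)).1 hdim ⟨e, he⟩
    exact ⟨c, (congrArg Subtype.val hc).symm⟩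
  obtain ⟨r, hr⟩ : ∃ c : ℝ, q - p = c • d := by
    refine hspan _ ?_
    rw [direction_affineSpan]
    exact vsub_mem_vectorSpan ℝ hq hp
  have hr0 : r ≠ 0 := by
    rintro rfl
    exact hpq (sub_eq_zero.1 (by simpa using hr)).symm
  have hp' := mem_reflP.1 hp.1.2
  have hq' := mem_reflP.1 hq.1.2
  set x := (1 / 2 : ℝ) • (p + q) with hx
  set y := (1 / 2 : ℝ) • (((2 : ℝ) • z - q) + ((2 : ℝ) • z - p)) with hy
  have hyx : (2 : ℝ) • z - x = y := by rw [hx, hy]; module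
  have hxP : x ∈ Permutohedron n := by
    have := convex_permutohedron n hp.1.1 hq.1.1 (a := 1 / 2) (b := 1 / 2) (by norm_num)
      (by norm_num) (by norm_num)
    rwa [← smul_add] at this
  have hyP : y ∈ Permutohedron n := by
    have := convex_permutohedron n hq' hp' (a := 1 / 2) (b := 1 / 2) (by norm_num)
      (by norm_num) (by norm_num)
    rwa [← smul_add] at this
  have hxE : x ∈ E := by
    refine ⟨⟨hxP, mem_reflP.2 (by rwa [hyx])⟩, fun w hw => ?_⟩
    have h1 := hp.2 w hw
    have h2 := hq.2 w hw
    have : x = p + (1 / 2 : ℝ) • (q - p) := by rw [hx]; module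
    have h3 : q = p + (1 : ℝ) • (q - p) := by module
    rw [h3, dot_add_smul] at h2
    rw [this, dot_add_smul]
    linarith
  have hdiv : ∀ {w : Vec n}, TightDir w (q - p) → TightDir w d := fun {w} hw S hS => by
    have := hw S hS
    rw [hr] at this
    simpa [← Finset.mul_sum, hr0] using this
  have hdx : TightDir x d := hdiv (tightDir_midpoint hp.1.1 hq.1.1)
  have hdy : TightDir y d := hdiv (by
    have := tightDir_midpoint hq' hp'
    rwa [sub_sub_sub_cancel_left] at this)
  have hline : ∀ e, TightDir x e → TightDir y e → ∃ c : ℝ, e = c • d := by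
    intro e hex hey
    refine hspan e ?_
    obtain ⟨ε, hε, hball⟩ := Metric.eventually_nhds_iff.1
      ((hex.eventually_mem hxP).and (hey.eventually_mem hyP))
    have h1 := hball (y := ε / 2) (by simp [abs_of_pos hε, hε])
    have h2 := hball (y := -(ε / 2)) (by simp [abs_of_pos hε, hε])
    refine smul_mem_direction_of_face (x := x) (t := ε / 2) (by positivity) hxE ⟨h1.1, ?_⟩ ⟨h2.1, ?_⟩
    · rw [mem_reflP]
      convert h2.2 using 1
      rw [← hyx]; module
    · rw [mem_reflP]
      convert h1.2 using 1
      rw [← hyx]; module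
  obtain ⟨c, u, hc, hu, rfl⟩ := exists_trinary_smul hd0 (hdx.sum_fiber_eq_zero hxP)
    (hdy.sum_fiber_eq_zero hyP) fun e h1 h2 =>
      hline e (tightDir_of_sum_fiber_eq_zero h1) (tightDir_of_sum_fiber_eq_zero h2)
  refine ⟨c, u, hc, fun h => hd0 (by simp [h]), hu, ?_, rfl⟩
  have hsum := hdx Finset.univ (by simp [tightSets, sum_eq_triangular_of_mem hxP])
  simp only [Pi.smul_apply, smul_eq_mul, ← Finset.mul_sum, mul_eq_zero, hc, false_or] at hsum
  rw [hu.sum_eq, sub_eq_zero, Nat.cast_inj] at hsum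
  exact hsum

lemma dot_card_filter_sub {n : ℕ} (A B : Finset (Finset (Fin n))) (w : Vec n) :
    dot (fun i => ((B.filter fun S => i ∈ S).card : ℝ) - (A.filter fun S => i ∈ S).card) w =
      ∑ S ∈ B, ∑ i ∈ S, w i - ∑ S ∈ A, ∑ i ∈ S, w i := by
  have h : ∀ C : Finset (Finset (Fin n)),
      ∑ S ∈ C, ∑ i ∈ S, w i = ∑ i, ((C.filter fun S => i ∈ S).card : ℝ) * w i := by
    intro C
    have : ∀ S : Finset (Fin n), ∑ i ∈ S, w i = ∑ i, if i ∈ S then w i else 0 := fun S => by simp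
    simp_rw [this]
    rw [Finset.sum_comm]
    refine Finset.sum_congr rfl fun i _ => ?_
    rw [← Finset.sum_filter, Finset.sum_const, nsmul_eq_mul]
  rw [h, h, dot, ← Finset.sum_sub_distrib]
  exact Finset.sum_congr rfl fun i _ => by ring

/-- A line of directions compatible with the tight sets of `x` and of `y` is an edge direction
of `P ∩ ρ_z P` for `z` the midpoint of `x` and `y`. -/
lemma edgeDir_of_tightDir {n : ℕ} {x y u : Vec n} (hx : x ∈ Permutohedron n)
    (hy : y ∈ Permutohedron n) (hu0 : u ≠ 0) (hux : TightDir x u) (huy : TightDir y u)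
    (h : ∀ e, TightDir x e → TightDir y e → ∃ c : ℝ, e = c • u) :
    EdgeDir (Permutohedron n) u := by
  set z := (1 / 2 : ℝ) • (x + y) with hz
  have hz2 : (2 : ℝ) • z = x + y := by rw [hz]; module
  have hzP : z ∈ Permutohedron n := by
    have := convex_permutohedron n hx hy (a := 1 / 2) (b := 1 / 2) (by norm_num)
      (by norm_num) (by norm_num)
    rwa [← smul_add] at this
  set f : Vec n := fun i => (((tightSets y).filter fun S => i ∈ S).card : ℝ) -
    ((tightSets x).filter fun S => i ∈ S).card with hf
  set Q := Permutohedron n ∩ reflP z (Permutohedron n) with hQ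
  have hxQ : x ∈ Q := ⟨hx, mem_reflP.2 (by rw [hz2, add_sub_cancel_left]; exact hy)⟩
  have hfx : ∀ S ∈ tightSets x, ∑ i ∈ S, x i = triangular S.card := fun S hS =>
    (Finset.mem_filter.1 hS).2
  have hfy : ∀ S ∈ tightSets y, ∑ i ∈ S, y i = triangular S.card := fun S hS =>
    (Finset.mem_filter.1 hS).2
  have hlex : ∀ w ∈ Q, ∀ S ∈ tightSets x, ∑ i ∈ S, x i ≤ ∑ i ∈ S, w i := fun w hw S hS => by
    rw [hfx S hS]; exact triangular_card_le_sum_of_mem hw.1 S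
  have hley : ∀ w ∈ Q, ∀ S ∈ tightSets y, ∑ i ∈ S, w i ≤ ∑ i ∈ S, x i := fun w hw S hS => by
    have := triangular_card_le_sum_of_mem (mem_reflP.1 hw.2) S
    rw [← hfy S hS, hz2] at this
    simp only [Pi.sub_apply, Pi.add_apply, Finset.sum_sub_distrib, Finset.sum_add_distrib] at this
    linarith
  set E := {x ∈ Q | ∀ y ∈ Q, dot f y ≤ dot f x} with hE
  have hxE : x ∈ E := by
    refine ⟨hxQ, fun w hw => ?_⟩
    rw [hf, dot_card_filter_sub, dot_card_filter_sub]
    exact sub_le_sub (Finset.sum_le_sum (hley w hw)) (Finset.sum_le_sum (hlex w hw))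
  have hEline : ∀ w ∈ E, ∃ c : ℝ, w - x = c • u := by
    intro w hw
    have hle := hw.2 x hxQ
    rw [hf, dot_card_filter_sub, dot_card_filter_sub] at hle
    have h1 := Finset.sum_le_sum (hley w hw.1)
    have h2 := Finset.sum_le_sum (hlex w hw.1)
    have e1 := (Finset.sum_eq_sum_iff_of_le (hley w hw.1)).1 (by linarith)
    have e2 := (Finset.sum_eq_sum_iff_of_le (hlex w hw.1)).1 (by linarith)
    refine h _ (fun S hS => ?_) fun S hS => ?_
    · simp [e2 S hS]
    · simp [e1 S hS]
  have hudir : u ∈ (affineSpan ℝ E).direction := by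
    obtain ⟨ε, hε, hball⟩ := Metric.eventually_nhds_iff.1
      ((hux.eventually_mem hx).and (huy.eventually_mem hy))
    have h1 := hball (y := ε / 2) (by simp [abs_of_pos hε, hε])
    have h2 := hball (y := -(ε / 2)) (by simp [abs_of_pos hε, hε])
    refine smul_mem_direction_of_face (x := x) (t := ε / 2) (by positivity) hxE ⟨h1.1, ?_⟩ ⟨h2.1, ?_⟩
    · rw [mem_reflP, hz2]
      convert h2.2 using 1
      module
    · rw [mem_reflP, hz2]
      convert h1.2 using 1
      module
  refine ⟨hu0, z, hzP, E, ⟨⟨f, rfl⟩, ?_⟩, hudir⟩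
  have hspan : (affineSpan ℝ E).direction = ℝ ∙ u := by
    refine le_antisymm ?_ (by simpa [Submodule.span_singleton_le_iff_mem] using hudir)
    rw [direction_affineSpan, vectorSpan_eq_span_vsub_set_right ℝ hxE, Submodule.span_le]
    rintro _ ⟨w, hw, rfl⟩
    obtain ⟨c, hc⟩ := hEline w hw
    exact Submodule.mem_span_singleton.2 ⟨c, hc.symm⟩
  rw [sdim, hspan, finrank_span_singleton hu0]

/-- The sequence `1, -1, 1, -1, …` with `2 k` nonzero terms. -/
def altSeq (k m : ℕ) : ℝ := if m < 2 * k then (-1) ^ m else 0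

lemma altSeq_trichotomy (k m : ℕ) :
    (m < 2 * k ∧ Even m ∧ altSeq k m = 1) ∨ (m < 2 * k ∧ Odd m ∧ altSeq k m = -1) ∨
      (2 * k ≤ m ∧ altSeq k m = 0) := by
  unfold altSeq
  rcases lt_or_ge m (2 * k) with h | h
  · rcases Nat.even_or_odd m with hm | hm
    · exact Or.inl ⟨h, hm, by rw [if_pos h, hm.neg_one_pow]⟩
    · exact Or.inr (Or.inl ⟨h, hm, by rw [if_pos h, hm.neg_one_pow]⟩)
  · exact Or.inr (Or.inr ⟨h, if_neg h.not_gt⟩)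

lemma sum_range_altSeq (k j : ℕ) :
    ∑ m ∈ Finset.range j, altSeq k m = if j < 2 * k ∧ Odd j then 1 else 0 := by
  induction j with
  | zero => simp
  | succ j ih =>
    rw [Finset.sum_range_succ, ih]
    rcases altSeq_trichotomy k j with ⟨h, hj, e⟩ | ⟨h, hj, e⟩ | ⟨h, e⟩ <;> rw [e]
    · obtain ⟨r, rfl⟩ := hj
      rw [if_neg (by rintro ⟨-, s, hs⟩; omega), if_pos ⟨by omega, r, by omega⟩]
      norm_num
    · obtain ⟨r, rfl⟩ := hj
      rw [if_pos ⟨h, r, rfl⟩, if_neg (by rintro ⟨-, s, hs⟩; omega)]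
      norm_num
    · rw [if_neg (by omega), if_neg (by omega)]
      norm_num

lemma sum_perm_initial {n : ℕ} (σ : Equiv.Perm (Fin n)) (g : ℕ → ℝ) {j : ℕ} (hj : j ≤ n) :
    ∑ i with (σ i : ℕ) < j, g (σ i) = ∑ m ∈ Finset.range j, g m := by
  rw [Finset.sum_filter, Equiv.sum_comp σ fun m : Fin n => if (m : ℕ) < j then g m else 0,
    Fin.sum_univ_eq_sum_range fun m => if m < j then g m else 0, ← Finset.sum_filter]
  refine Finset.sum_congr ?_ fun _ _ => rfl
  ext m
  simp only [Finset.mem_filter, Finset.mem_range]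
  omega

lemma card_perm_initial {n : ℕ} (σ : Equiv.Perm (Fin n)) {j : ℕ} (hj : j ≤ n) :
    (Finset.univ.filter fun i => (σ i : ℕ) < j).card = j := by
  have := sum_perm_initial σ (fun _ => 1) hj
  simp only [Finset.sum_const, nsmul_eq_mul, mul_one, Finset.card_range] at this
  exact_mod_cast this

/-- The involution of `Fin n` exchanging `2 s` and `2 s + 1` for all `s < k`. -/
def swapPairs {n k : ℕ} (hk : 2 * k ≤ n) : Equiv.Perm (Fin n) :=
  Function.Involutive.toPerm
    (fun m => ⟨if m.val < 2 * k then if m.val % 2 = 0 then m.val + 1 else m.val - 1 else m.val, by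
      have := m.isLt
      split_ifs <;> omega⟩)
    fun m => by
      ext
      dsimp only
      split_ifs <;> omega

/-- The permutation of `Fin n` shifting the first `2 k` elements cyclically by `-1`. -/
def rotateInitial {n k : ℕ} (hk : 2 * k ≤ n) : Equiv.Perm (Fin n) where
  toFun m := ⟨if m.val < 2 * k then if m.val = 0 then 2 * k - 1 else m.val - 1 else m.val, by
    have := m.isLt
    split_ifs <;> omega⟩
  invFun m := ⟨if m.val < 2 * k then if m.val + 1 = 2 * k then 0 else m.val + 1 else m.val, by
    have := m.isLt
    split_ifs <;> omega⟩
  left_inv m := by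
    ext
    dsimp only
    split_ifs <;> omega
  right_inv m := by
    ext
    dsimp only
    split_ifs <;> first | contradiction | omega

lemma rotateInitial_val {n k : ℕ} (hk : 2 * k ≤ n) (m : Fin n) : (rotateInitial hk m : ℕ) =
    if m.val < 2 * k then if m.val = 0 then 2 * k - 1 else m.val - 1 else m.val := rfl

lemma altSeq_rotateInitial {n k : ℕ} (hk : 2 * k ≤ n) (m : Fin n) :
    altSeq k (rotateInitial hk m) = -altSeq k m := by
  rw [rotateInitial_val]
  rcases altSeq_trichotomy k m with ⟨h, ⟨r, hr⟩, e⟩ | ⟨h, ⟨r, hr⟩, e⟩ | ⟨h, e⟩ <;> rw [e]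
  · rw [if_pos h]
    split_ifs with h0
    · rcases altSeq_trichotomy k (2 * k - 1) with ⟨h, ⟨s, hs⟩, e⟩ | ⟨h, ⟨s, hs⟩, e⟩ | ⟨h, e⟩
      · omega
      · exact e
      · omega
    · rcases altSeq_trichotomy k (m.val - 1) with ⟨h, ⟨s, hs⟩, e⟩ | ⟨h, ⟨s, hs⟩, e⟩ | ⟨h, e⟩
      · omega
      · exact e
      · omega
  · rw [if_pos h, if_neg (show ¬m.val = 0 by omega)]
    rcases altSeq_trichotomy k (m.val - 1) with ⟨h, ⟨s, hs⟩, e⟩ | ⟨h, ⟨s, hs⟩, e⟩ | ⟨h, e⟩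
    · rw [e, neg_neg]
    · omega
    · omega
  · rw [if_neg h.not_gt, e, neg_zero]

lemma permVertex_trans_swapPairs {n k : ℕ} (hk : 2 * k ≤ n) (σ : Equiv.Perm (Fin n)) :
    permVertex (σ.trans (swapPairs hk)) = permVertex σ + fun i => altSeq k (σ i) := by
  ext i
  have hval : ((σ.trans (swapPairs hk)) i : ℕ) = if (σ i).val < 2 * k then
    if (σ i).val % 2 = 0 then (σ i).val + 1 else (σ i).val - 1 else (σ i).val := rfl
  simp only [permVertex, hval, Pi.add_apply]
  rcases altSeq_trichotomy k (σ i) with ⟨h, ⟨r, hr⟩, e⟩ | ⟨h, ⟨r, hr⟩, e⟩ | ⟨h, e⟩ <;> rw [e]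
  · rw [if_pos h, if_pos (by omega)]
    push_cast
    ring
  · rw [if_pos h, if_neg (by omega), hr]
    push_cast [Nat.add_sub_cancel]
    ring
  · rw [if_neg h.not_gt, add_zero]

/-- The midpoint of a vertex of the permutahedron and of the vertex obtained from it by exchanging
the first `k` pairs of consecutive values. -/
def pairsMidpoint {n k : ℕ} (hk : 2 * k ≤ n) (σ : Equiv.Perm (Fin n)) : Vec n :=
  (1 / 2 : ℝ) • (permVertex σ + permVertex (σ.trans (swapPairs hk)))

lemma pairsMidpoint_mem {n k : ℕ} (hk : 2 * k ≤ n) (σ : Equiv.Perm (Fin n)) :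
    pairsMidpoint hk σ ∈ Permutohedron n := by
  have := convex_permutohedron n (permVertex_mem σ) (permVertex_mem (σ.trans (swapPairs hk)))
    (a := 1 / 2) (b := 1 / 2) (by norm_num) (by norm_num) (by norm_num)
  rwa [← smul_add] at this

lemma tightDir_pairsMidpoint {n k : ℕ} (hk : 2 * k ≤ n) (σ : Equiv.Perm (Fin n)) :
    TightDir (pairsMidpoint hk σ) fun i => altSeq k (σ i) := by
  have := tightDir_midpoint (permVertex_mem σ) (permVertex_mem (σ.trans (swapPairs hk)))
  rwa [permVertex_trans_swapPairs hk, add_sub_cancel_left,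
    ← permVertex_trans_swapPairs hk] at this

lemma initial_mem_tightSets {n k : ℕ} (hk : 2 * k ≤ n) (σ : Equiv.Perm (Fin n)) {j : ℕ}
    (hj : j ≤ n) (hjk : ¬(j < 2 * k ∧ Odd j)) :
    (Finset.univ.filter fun i => (σ i : ℕ) < j) ∈ tightSets (pairsMidpoint hk σ) := by
  have hmid : pairsMidpoint hk σ = fun i => ((σ i : ℕ) : ℝ) + 1 + altSeq k (σ i) / 2 := by
    rw [pairsMidpoint, permVertex_trans_swapPairs]
    ext i
    simp only [Pi.smul_apply, Pi.add_apply, permVertex, smul_eq_mul]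
    ring
  rw [tightSets, Finset.mem_filter, card_perm_initial σ hj, hmid,
    sum_perm_initial σ (fun m => (m : ℝ) + 1 + altSeq k m / 2) hj, Finset.sum_add_distrib,
    ← Finset.sum_div, sum_range_altSeq, if_neg hjk, Finset.sum_range (fun m => (m : ℝ) + 1),
    sum_fin_val_add_one]
  simp

lemma TightDir.sum_initial {n k : ℕ} {hk : 2 * k ≤ n} {σ : Equiv.Perm (Fin n)} {e : Vec n}
    (he : TightDir (pairsMidpoint hk σ) e) {j : ℕ} (hj : j ≤ n) (hjk : ¬(j < 2 * k ∧ Odd j)) :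
    ∑ m ∈ Finset.range j, (if h : m < n then e (σ.symm ⟨m, h⟩) else 0) = 0 := by
  rw [← sum_perm_initial σ _ hj, ← he _ (initial_mem_tightSets hk σ hj hjk)]
  refine Finset.sum_congr rfl fun i _ => ?_
  simp

lemma TightDir.apply_eq_zero {n k : ℕ} {hk : 2 * k ≤ n} {σ : Equiv.Perm (Fin n)} {e : Vec n}
    (he : TightDir (pairsMidpoint hk σ) e) {i : Fin n} (hi : 2 * k ≤ σ i) : e i = 0 := by
  have h1 := he.sum_initial (j := σ i) (σ i).isLt.le (by omega)
  have h2 := he.sum_initial (j := σ i + 1) (σ i).isLt (by omega)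
  rw [Finset.sum_range_succ, h1] at h2
  simpa using h2

lemma TightDir.apply_add_apply_eq_zero {n k : ℕ} {hk : 2 * k ≤ n} {σ : Equiv.Perm (Fin n)}
    {e : Vec n} (he : TightDir (pairsMidpoint hk σ) e) {i j : Fin n}
    (heven : Even (σ i : ℕ)) (hij : (σ j : ℕ) = σ i + 1) : e i + e j = 0 := by
  obtain ⟨r, hr⟩ := heven
  have hj := (σ j).isLt
  have h1 := he.sum_initial (j := σ i) (σ i).isLt.le (by rintro ⟨-, s, hs⟩; omega)
  have h2 := he.sum_initial (j := σ i + 1 + 1) (by omega) (by rintro ⟨-, s, hs⟩; omega)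
  rw [Finset.sum_range_succ, Finset.sum_range_succ, h1, ← hij] at h2
  simpa using h2

lemma edgeDir_altSeq {n k : ℕ} (hk : 2 * k ≤ n) (σ : Equiv.Perm (Fin n))
    (h0 : (fun i => altSeq k (σ i) : Vec n) ≠ 0) :
    EdgeDir (Permutohedron n) fun i => altSeq k (σ i) := by
  refine edgeDir_of_tightDir (pairsMidpoint_mem hk σ)
    (pairsMidpoint_mem hk (σ.trans (rotateInitial hk))) h0 (tightDir_pairsMidpoint hk σ) ?_ ?_
  · intro S hS
    have := tightDir_pairsMidpoint hk (σ.trans (rotateInitial hk)) S hS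
    simpa [altSeq_rotateInitial] using this
  intro e hx hy
  obtain ⟨i₀, -⟩ := Function.ne_iff.1 h0
  have hn : 0 < n := i₀.pos
  refine ⟨e (σ.symm ⟨0, hn⟩), ?_⟩
  have key : ∀ m (hm : m < n), m < 2 * k →
      e (σ.symm ⟨m, hm⟩) = e (σ.symm ⟨0, hn⟩) * (-1) ^ m := by
    intro m
    induction m with
    | zero => simp
    | succ m ih =>
      intro hm hmk
      have hprev := ih (by omega) (by omega)
      have hstep : e (σ.symm ⟨m, by omega⟩) + e (σ.symm ⟨m + 1, hm⟩) = 0 := by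
        rcases Nat.even_or_odd m with hpar | hpar
        · refine hx.apply_add_apply_eq_zero ?_ ?_ <;> simp only [Equiv.apply_symm_apply]
          exact hpar
        · obtain ⟨r, rfl⟩ := hpar
          have e1 : ((σ.trans (rotateInitial hk)) (σ.symm ⟨2 * r + 1, by omega⟩) : ℕ) = 2 * r := by
            rw [Equiv.trans_apply, Equiv.apply_symm_apply, rotateInitial_val,
              if_pos (show 2 * r + 1 < 2 * k by omega),
              if_neg (by simp)]
            rfl
          have e2 : ((σ.trans (rotateInitial hk)) (σ.symm ⟨2 * r + 1 + 1, hm⟩) : ℕ) =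
              2 * r + 1 := by
            rw [Equiv.trans_apply, Equiv.apply_symm_apply, rotateInitial_val, if_pos hmk,
              if_neg (by simp)]
            rfl
          refine hy.apply_add_apply_eq_zero ?_ ?_
          · rw [e1]; exact even_two_mul r
          · rw [e1, e2]
      rw [eq_neg_of_add_eq_zero_right hstep, hprev, pow_succ]
      ring
  ext i
  simp only [Pi.smul_apply, smul_eq_mul]
  by_cases hi : (σ i : ℕ) < 2 * k
  · rw [altSeq, if_pos hi, ← key _ (σ i).isLt hi]
    simp
  · rw [hx.apply_eq_zero (not_lt.1 hi), altSeq, if_neg hi, mul_zero]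

lemma Trinary.card_add_card_add_card {n : ℕ} {u : Vec n} (hu : Trinary u) :
    (Finset.univ.filter fun i => u i = 0).card + (Finset.univ.filter fun i => u i = 1).card +
      (Finset.univ.filter fun i => u i = -1).card = n := by
  simp only [Finset.card_filter]
  rw [← Finset.sum_add_distrib, ← Finset.sum_add_distrib]
  conv_rhs => rw [← Fintype.card_fin n, ← Finset.card_univ, Finset.card_eq_sum_ones]
  refine Finset.sum_congr rfl fun i _ => ?_
  obtain h | h | h := hu i <;> rw [h] <;> norm_num

/-- Balanced trinary vectors with the same number of zeros agree up to a permutation. -/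
lemma exists_perm_of_balanced {n : ℕ} {u v : Vec n} (hu : Trinary u) (hv : Trinary v)
    (hub : BalancedVec u) (hvb : BalancedVec v)
    (h0 : (Finset.univ.filter fun i => u i = 0).card =
      (Finset.univ.filter fun i => v i = 0).card) :
    ∃ σ : Equiv.Perm (Fin n), ∀ i, v (σ i) = u i := by
  have hu3 := hu.card_add_card_add_card
  have hv3 := hv.card_add_card_add_card
  unfold BalancedVec at hub hvb
  have hcard : ∀ y : ℝ, Fintype.card {i // u i = y} = Fintype.card {i // v i = y} := by
    intro y
    rw [Fintype.card_subtype, Fintype.card_subtype]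
    by_cases hy : y = 0 ∨ y = 1 ∨ y = -1
    · obtain rfl | rfl | rfl := hy <;> omega
    · rw [Finset.filter_false_of_mem fun i _ hiy => hy (by rw [← hiy]; exact hu i),
        Finset.filter_false_of_mem fun i _ hiy => hy (by rw [← hiy]; exact hv i)]
  exact ⟨Equiv.ofFiberEquiv fun y => Fintype.equivOfCardEq (hcard y),
    fun i => Equiv.ofFiberEquiv_map _ i⟩

/-- Balanced trinary vectors are edge directions. -/
lemma edgeDir_of_trinary {n : ℕ} {u : Vec n} (hu0 : u ≠ 0) (hu : Trinary u)
    (hub : BalancedVec u) : EdgeDir (Permutohedron n) u := by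
  set k := (Finset.univ.filter fun i => u i = 1).card with hk
  have hu3 := hu.card_add_card_add_card
  have hub' : k = (Finset.univ.filter fun i => u i = -1).card := hub
  have hkn : 2 * k ≤ n := by omega
  have hv : Trinary fun m : Fin n => altSeq k m := fun m => by
    rcases altSeq_trichotomy k m with ⟨-, -, e⟩ | ⟨-, -, e⟩ | ⟨-, e⟩ <;> simp [e]
  have hvb : BalancedVec fun m : Fin n => altSeq k m := by
    have h := hv.sum_eq
    rw [Fin.sum_univ_eq_sum_range fun m => altSeq k m, sum_range_altSeq, if_neg (by omega)] at h
    rw [eq_comm, sub_eq_zero, Nat.cast_inj] at h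
    exact h
  have hv0 : (Finset.univ.filter fun m : Fin n => altSeq k m = 0).card = n - 2 * k := by
    have hset : (Finset.univ.filter fun m : Fin n => altSeq k m = 0) =
        Finset.univ.filter fun m : Fin n => ¬ m.val < 2 * k := by
      ext m
      rcases altSeq_trichotomy k m with ⟨h, -, e⟩ | ⟨h, -, e⟩ | ⟨h, e⟩ <;> simp [e, h]
    have h := Finset.card_filter_add_card_filter_not (s := (Finset.univ : Finset (Fin n)))
      fun m => m.val < 2 * k
    rw [Fin.card_filter_val_lt, Finset.card_univ, Fintype.card_fin] at h
    rw [hset]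
    omega
  obtain ⟨σ, hσ⟩ := exists_perm_of_balanced hu hv hub hvb (by omega)
  have hσu : (fun i => altSeq k (σ i)) = u := funext hσ
  have hdir := edgeDir_altSeq hkn σ (by rw [hσu]; exact hu0)
  rwa [hσu] at hdir

lemma EdgeDir.smul {n : ℕ} {P : Set (Vec n)} {d : Vec n} (hd : EdgeDir P d) {c : ℝ}
    (hc : c ≠ 0) : EdgeDir P (c • d) := by
  obtain ⟨hd0, z, hz, E, hE, hdE⟩ := hd
  exact ⟨smul_ne_zero hc hd0, z, hz, E, hE, Submodule.smul_mem _ c hdE⟩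

lemma exists_first_ne_zero {n : ℕ} {u : Vec n} (hu : u ≠ 0) :
    ∃ i, u i ≠ 0 ∧ ∀ j < i, u j = 0 := by
  obtain ⟨i, hi⟩ := Function.ne_iff.1 hu
  obtain ⟨m, hm, hmin⟩ := Finset.exists_min_image
    (Finset.univ.filter fun i => u i ≠ 0) id ⟨i, by simpa using hi⟩
  simp only [Finset.mem_filter, Finset.mem_univ, true_and, id] at hm hmin
  refine ⟨m, hm, fun j hj => ?_⟩
  by_contra h
  exact (hmin j h).not_gt hj

lemma exists_firstPos_smul {n : ℕ} {u : Vec n} (hu0 : u ≠ 0) (hu : Trinary u)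
    (hub : BalancedVec u) : ∃ (c : ℝ) (v : Vec n), c ≠ 0 ∧ v ≠ 0 ∧ Trinary v ∧ BalancedVec v ∧
      FirstPos v ∧ u = c • v := by
  obtain ⟨i, hi, hlt⟩ := exists_first_ne_zero hu0
  have huniq : ∀ j, u j ≠ 0 → (∀ l < j, u l = 0) → j = i := fun j hj hjl =>
    le_antisymm (not_lt.1 fun h => hi (hjl i h)) (not_lt.1 fun h => hj (hlt j h))
  obtain h | h | h := hu i
  · exact absurd h hi
  · exact ⟨1, u, one_ne_zero, hu0, hu, hub, fun j hj hjl => huniq j hj hjl ▸ h, by simp⟩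
  · refine ⟨-1, -u, by norm_num, neg_ne_zero.2 hu0, fun j => ?_, ?_, fun j hj hjl => ?_, by simp⟩
    · obtain h | h | h := hu j <;> simp [h]
    · have : BalancedVec u := hub
      unfold BalancedVec at this ⊢
      simp only [Pi.neg_apply, neg_inj, neg_eq_iff_eq_neg (b := (1 : ℝ))]
      exact this.symm
    · rw [huniq j (by simpa using hj) fun l hl => by simpa using hjl l hl]
      simp [h]

/-- A trinary vector is a difference of two indicator vectors. -/
lemma Trinary.eq_indicator_sub {n : ℕ} {u : Vec n} (hu : Trinary u) :
    u = fun i => (if i ∈ Finset.univ.filter (fun i => u i = 1) then (1 : ℝ) else 0) -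
      if i ∈ Finset.univ.filter (fun i => u i = -1) then 1 else 0 := by
  ext i
  simp only [Finset.mem_filter, Finset.mem_univ, true_and]
  obtain h | h | h := hu i <;> rw [h] <;> norm_num

lemma dPair_of_firstPos {n : ℕ} {u : Vec n} (hu0 : u ≠ 0) (hub : BalancedVec u)
    (hfirst : FirstPos u) :
    DPair (Finset.univ.filter fun i => u i = 1) (Finset.univ.filter fun i => u i = -1) := by
  refine ⟨hub, ?_, ?_⟩
  · rw [Finset.disjoint_filter]
    intro i _ h
    rw [h]
    norm_num
  · obtain ⟨i, hi, hlt⟩ := exists_first_ne_zero hu0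
    refine ⟨i, by simpa using hfirst i hi hlt, fun x hx => not_lt.1 fun h => ?_⟩
    have := hlt x h
    simp [this] at hx

lemma DPair.edgeDir {n : ℕ} {I J : Finset (Fin n)} (h : DPair I J) :
    EdgeDir (Permutohedron n)
      fun i => (if i ∈ I then (1 : ℝ) else 0) - if i ∈ J then 1 else 0 := by
  obtain ⟨hcard, hdisj, i, hi, -⟩ := h
  have hIJ : ∀ j, j ∈ I → j ∉ J := fun j hj => Finset.disjoint_left.1 hdisj hj
  refine edgeDir_of_trinary (Function.ne_iff.2 ⟨i, by simp [hi, hIJ i hi]⟩) (fun j => ?_) ?_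
  · have := hIJ j
    by_cases h1 : j ∈ I <;> by_cases h2 : j ∈ J <;> simp_all
  · unfold BalancedVec
    convert hcard using 2
    · ext j
      have := hIJ j
      by_cases h1 : j ∈ I <;> by_cases h2 : j ∈ J <;> (simp_all <;> norm_num)
    · ext j
      have := hIJ j
      by_cases h1 : j ∈ I <;> by_cases h2 : j ∈ J <;> (simp_all <;> norm_num)

/-- Fundamental hyperplane arrangement of the permutahedron. The directions
of the edges of `P ∩ ρ_z P`, over all `z ∈ P`, for `P` the `(n-1)`-dimensional permutahedron,
are exactly the nonzero multiples of the vectors `χ_I - χ_J` for `(I, J) ∈ D(n)`; equivalently,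
they are exactly the nonzero multiples of the nonzero trinary vectors with the same number of
`1`s and `-1`s and first nonzero coordinate `1`.  In other words, the fundamental hyperplane
arrangement `H_P` is exactly `{Σ_{i ∈ I} x_i = Σ_{j ∈ J} x_j : (I, J) ∈ D(n)}`. -/
theorem stmt16 (n : ℕ) (hn : 1 ≤ n) :
    ({d : Vec n | EdgeDir (Permutohedron n) d} =
      {d : Vec n | ∃ (I J : Finset (Fin n)) (c : ℝ), DPair I J ∧ c ≠ 0 ∧
        d = c • (fun i => (if i ∈ I then (1 : ℝ) else 0) - if i ∈ J then 1 else 0)}) ∧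
    ({d : Vec n | EdgeDir (Permutohedron n) d} =
      {d : Vec n | ∃ (c : ℝ) (u : Vec n), c ≠ 0 ∧ u ≠ 0 ∧
        Trinary u ∧ BalancedVec u ∧ FirstPos u ∧ d = c • u}) := by
  have hfirst : ∀ d, EdgeDir (Permutohedron n) d → ∃ (c : ℝ) (u : Vec n), c ≠ 0 ∧ u ≠ 0 ∧
      Trinary u ∧ BalancedVec u ∧ FirstPos u ∧ d = c • u := by
    intro d hd
    obtain ⟨c, u, hc, hu0, hu, hub, rfl⟩ := hd.exists_trinary
    obtain ⟨b, v, hb, hv0, hv, hvb, hvf, rfl⟩ := exists_firstPos_smul hu0 hu hub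
    exact ⟨c * b, v, mul_ne_zero hc hb, hv0, hv, hvb, hvf, smul_smul c b v⟩
  refine ⟨Set.Subset.antisymm ?_ ?_, Set.Subset.antisymm hfirst ?_⟩
  · intro d hd
    obtain ⟨c, u, hc, hu0, hu, hub, huf, hdu⟩ := hfirst d hd
    exact ⟨_, _, c, dPair_of_firstPos hu0 hub huf, hc, by rw [← hu.eq_indicator_sub, hdu]⟩
  · rintro _ ⟨I, J, c, hIJ, hc, rfl⟩
    exact hIJ.edgeDir.smul hc
  · rintro _ ⟨c, u, hc, hu0, hu, hub, -, rfl⟩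
    exact (edgeDir_of_trinary hu0 hu hub).smul hc
end
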